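/- Let Ω ⊆ ℝ³ be a domain convex in the directions of the lines L₁ and L₂, assume that at least one number in each of the pairs (a₁, b₁) and (a₂, b₂) lies in ℂ∖ℝ, and let Φ̂ : Ω_ζ → ℍ(ℂ) be left-G-monogenic in Ω_ζ. If ζ₁, ζ₂ ∈ Ω_ζ satisfy ζ₁ − ζ₂ ∈ {x i₁ + y i₂ + z i₃ : (x,y,z) ∈ L₁}, then Φ̂(ζ₁) − Φ̂(ζ₂) ∈ 𝓘̂₁; if ζ₁ − ζ₂ ∈ {x i₁ + y i₂ + z i₃ : (x,y,z) ∈ L₂}, then Φ̂(ζ₁) − Φ̂(ζ₂) ∈ 𝓘̂₂. -/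

import Mathlib

open Filter Set Topology Quaternion

noncomputable section

abbrev HC : Type := ℍ[ℂ, -1, -1]

/-- The idempotent `e₁ = (1 + iI)/2`. -/
def e1 : HC := ⟨1/2, Complex.I/2, 0, 0⟩
/-- The idempotent `e₂ = (1 - iI)/2`. -/
def e2 : HC := ⟨1/2, -(Complex.I/2), 0, 0⟩
/-- `e₃ = (iJ - K)/2`. -/
def e3 : HC := ⟨0, 0, Complex.I/2, -(1/2)⟩
/-- `e₄ = (iJ + K)/2`. -/
def e4 : HC := ⟨0, 0, Complex.I/2, 1/2⟩

/-- Topology on `ℍ(ℂ)` induced from the four complex coordinates. -/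
instance : TopologicalSpace HC :=
  TopologicalSpace.induced (fun q : HC => (q.re, q.imI, q.imJ, q.imK)) inferInstance

/-- Coordinate of `a ∈ ℍ(ℂ)` at `e₁` in the basis `{e₁, e₂, e₃, e₄}`. -/
def c1 (a : HC) : ℂ := a.re - Complex.I * a.imI
/-- Coordinate at `e₂`. -/
def c2 (a : HC) : ℂ := a.re + Complex.I * a.imI
/-- Coordinate at `e₃`. -/
def c3 (a : HC) : ℂ := -(Complex.I * a.imJ) - a.imK
/-- Coordinate at `e₄`. -/
def c4 (a : HC) : ℂ := -(Complex.I * a.imJ) + a.imK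

/-- The norm `‖a‖ = √(|a₁|² + |a₂|² + |a₃|² + |a₄|²)`, coordinates in the basis `{e₁,e₂,e₃,e₄}`. -/
def qnorm (a : HC) : ℝ :=
  Real.sqrt (‖c1 a‖ ^ 2 + ‖c2 a‖ ^ 2 +
    ‖c3 a‖ ^ 2 + ‖c4 a‖ ^ 2)

/-- `f₁ : ℍ(ℂ) → ℂ`, the ℂ-linear functional with `f₁(e₁) = f₁(e₃) = 1`, `f₁(e₂) = f₁(e₄) = 0`. -/
def f1 (a : HC) : ℂ := c1 a + c3 a
/-- `f₂ : ℍ(ℂ) → ℂ`, with `f₂(e₂) = f₂(e₄) = 1`, `f₂(e₁) = f₂(e₃) = 0`. -/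
def f2 (a : HC) : ℂ := c2 a + c4 a
/-- `f̂₁ : ℍ(ℂ) → ℂ`, with `f̂₁(e₁) = f̂₁(e₄) = 1`, `f̂₁(e₂) = f̂₁(e₃) = 0`. -/
def fh1 (a : HC) : ℂ := c1 a + c4 a
/-- `f̂₂ : ℍ(ℂ) → ℂ`, with `f̂₂(e₂) = f̂₂(e₃) = 1`, `f̂₂(e₁) = f̂₂(e₄) = 0`. -/
def fh2 (a : HC) : ℂ := c2 a + c3 a

/-- `ζ = x i₁ + y i₂ + z i₃` for `p = (x, y, z) ∈ ℝ³` (with `i₁ = 1`). -/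
def zeta (i2 i3 : HC) (p : ℝ × ℝ × ℝ) : HC :=
  (p.1 : ℂ) • (1 : HC) + (p.2.1 : ℂ) • i2 + (p.2.2 : ℂ) • i3

/-- The real linear span `E₃` of `i₁ = 1, i₂, i₃`. -/
def E3 (i2 i3 : HC) : Set HC := Set.range (zeta i2 i3)

/-- `i₁ = 1, i₂, i₃` are linearly independent over `ℝ`. -/
def LinIndep (i2 i3 : HC) : Prop :=
  ∀ α₁ α₂ α₃ : ℝ, (α₁ : ℂ) • (1 : HC) + (α₂ : ℂ) • i2 + (α₃ : ℂ) • i3 = 0 →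
    α₁ = 0 ∧ α₂ = 0 ∧ α₃ = 0

/-- `Φ` is right-G-monogenic on `S` (w.r.t. directions in `E₃`): it is continuous on `S` and at
every `ζ ∈ S` there is `Φ'(ζ)` with `lim_{ε→0+} (Φ(ζ+εh) − Φ(ζ))ε⁻¹ = h·Φ'(ζ)` for all `h ∈ E₃`. -/
def RightGMonogenic (i2 i3 : HC) (Φ : HC → HC) (S : Set HC) : Prop :=
  ContinuousOn Φ S ∧ ∀ ζ ∈ S, ∃ Φ' : HC, ∀ h ∈ E3 i2 i3,
    Tendsto (fun ε : ℝ => ((ε : ℂ))⁻¹ • (Φ (ζ + (ε : ℂ) • h) - Φ ζ))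
      (nhdsWithin 0 (Set.Ioi 0)) (nhds (h * Φ'))

/-- `Φ̂` is left-G-monogenic on `S`. -/
def LeftGMonogenic (i2 i3 : HC) (Φ : HC → HC) (S : Set HC) : Prop :=
  ContinuousOn Φ S ∧ ∀ ζ ∈ S, ∃ Φ' : HC, ∀ h ∈ E3 i2 i3,
    Tendsto (fun ε : ℝ => ((ε : ℂ))⁻¹ • (Φ (ζ + (ε : ℂ) • h) - Φ ζ))
      (nhdsWithin 0 (Set.Ioi 0)) (nhds (Φ' * h))

/-- The right maximal ideal `𝓘₁ = {λ₂e₂ + λ₄e₄}`. -/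
def I1 : Set HC := {a | ∃ l2 l4 : ℂ, a = l2 • e2 + l4 • e4}
/-- The right maximal ideal `𝓘₂ = {λ₁e₁ + λ₃e₃}`. -/
def I2 : Set HC := {a | ∃ l1 l3 : ℂ, a = l1 • e1 + l3 • e3}
/-- The left maximal ideal `𝓘̂₁ = {λ₂e₂ + λ₃e₃}`. -/
def Ih1 : Set HC := {a | ∃ l2 l3 : ℂ, a = l2 • e2 + l3 • e3}
/-- The left maximal ideal `𝓘̂₂ = {λ₁e₁ + λ₄e₄}`. -/
def Ih2 : Set HC := {a | ∃ l1 l4 : ℂ, a = l1 • e1 + l4 • e4}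

/-- The line `L` in `ℝ³` given by `x + y·Re a + z·Re b = 0`, `y·Im a + z·Im b = 0`. -/
def lineL (a b : ℂ) : Set (ℝ × ℝ × ℝ) :=
  {p | p.1 + p.2.1 * a.re + p.2.2 * b.re = 0 ∧ p.2.1 * a.im + p.2.2 * b.im = 0}

/-- `Ω` is convex in the direction of the line `L` (a line through the origin): it contains every
segment parallel to `L` joining two of its points. -/
def ConvexInDirection (Ω : Set (ℝ × ℝ × ℝ)) (L : Set (ℝ × ℝ × ℝ)) : Prop :=
  ∀ p ∈ Ω, ∀ q ∈ Ω, q - p ∈ L → segment ℝ p q ⊆ Ω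

/-- `ξ = x + y·a + z·b` for `p = (x,y,z)`. -/
def xi (a b : ℂ) (p : ℝ × ℝ × ℝ) : ℂ := (p.1 : ℂ) + (p.2.1 : ℂ) * a + (p.2.2 : ℂ) * b


/-- `Φ'` is a right Gateaux derivative of `Φ` on `S` (directions in `E₃`). -/
def IsRightGDeriv (i2 i3 : HC) (Φ Φ' : HC → HC) (S : Set HC) : Prop :=
  ∀ ζ ∈ S, ∀ h ∈ E3 i2 i3,
    Tendsto (fun ε : ℝ => ((ε : ℂ))⁻¹ • (Φ (ζ + (ε : ℂ) • h) - Φ ζ))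
      (nhdsWithin 0 (Set.Ioi 0)) (nhds (h * Φ' ζ))

/-- `Φ'` is a left Gateaux derivative of `Φ` on `S`. -/
def IsLeftGDeriv (i2 i3 : HC) (Φ Φ' : HC → HC) (S : Set HC) : Prop :=
  ∀ ζ ∈ S, ∀ h ∈ E3 i2 i3,
    Tendsto (fun ε : ℝ => ((ε : ℂ))⁻¹ • (Φ (ζ + (ε : ℂ) • h) - Φ ζ))
      (nhdsWithin 0 (Set.Ioi 0)) (nhds (Φ' ζ * h))

/-- Triples `(α, β, γ)` of naturals with `α + β + γ = n`. -/
def trip (n : ℕ) : Finset (ℕ × ℕ × ℕ) :=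
  (Finset.range (n + 1) ×ˢ Finset.range (n + 1) ×ˢ Finset.range (n + 1)).filter
    (fun u => u.1 + u.2.1 + u.2.2 = n)

lemma aux_const (i2 i3 : HC) (Φ : HC → HC) (S : Set HC) (hΦ : LeftGMonogenic i2 i3 Φ S)
    (ζ h : HC) (hh : h ∈ E3 i2 i3) (hseg : ∀ t : ℝ, t ∈ Set.Icc (0:ℝ) 1 → ζ + (t : ℂ) • h ∈ S)
    (g : HC →ₗ[ℂ] ℂ) (hg : Continuous g) (h0 : ∀ q : HC, g (q * h) = 0) :
    g (Φ (ζ + h)) = g (Φ ζ) := by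
  have hcont : Continuous (fun t : ℝ => ζ + (t : ℂ) • h) := by
    rw [continuous_induced_rng]
    simp only [Function.comp_def, QuaternionAlgebra.re_add, QuaternionAlgebra.imI_add,
      QuaternionAlgebra.imJ_add, QuaternionAlgebra.imK_add, QuaternionAlgebra.re_smul,
      QuaternionAlgebra.imI_smul, QuaternionAlgebra.imJ_smul, QuaternionAlgebra.imK_smul,
      smul_eq_mul]
    fun_prop
  have key := constant_of_has_deriv_right_zero (f := fun t : ℝ => g (Φ (ζ + (t : ℂ) • h)))
    (a := 0) (b := 1) ?_ ?_ 1 (by simp)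
  · simpa using key
  · exact hg.comp_continuousOn (hΦ.1.comp hcont.continuousOn hseg)
  · intro x hx
    obtain ⟨Φ', hΦ'⟩ := hΦ.2 _ (hseg x ⟨hx.1, hx.2.le⟩)
    have ht := (hg.tendsto _).comp (hΦ' h hh)
    rw [h0] at ht
    rw [← hasDerivWithinAt_Ioi_iff_Ici, hasDerivWithinAt_iff_tendsto_slope' (by simp)]
    have hsub : Tendsto (fun y : ℝ => y - x) (𝓝[>] x) (𝓝[>] 0) := by
      apply tendsto_nhdsWithin_of_tendsto_nhds_of_eventually_within
      · have : Tendsto (fun y : ℝ => y - x) (𝓝 x) (𝓝 (x - x)) :=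
          (continuous_id.sub continuous_const).tendsto x
        rw [sub_self] at this
        exact this.mono_left nhdsWithin_le_nhds
      · filter_upwards [self_mem_nhdsWithin] with y hy
        simpa using hy
    refine (ht.comp hsub).congr fun y => ?_
    have e : ζ + (x : ℂ) • h + ((y - x : ℝ) : ℂ) • h = ζ + (y : ℂ) • h := by
      push_cast
      module
    simp only [Function.comp_def, e, map_smul, map_sub, slope_def_module]
    rw [← Complex.ofReal_inv, Complex.coe_smul]

lemma mem_Ih1 (a : HC) (h1 : c1 a = 0) (h4 : c4 a = 0) : a ∈ Ih1 := by
  have hI := Complex.I_mul_I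
  refine ⟨c2 a, c3 a, ?_⟩
  simp only [c1, c2, c3, c4] at *
  ext <;> simp [e2, e3] <;> grind

lemma mem_Ih2 (a : HC) (h1 : c2 a = 0) (h4 : c3 a = 0) : a ∈ Ih2 := by
  have hI := Complex.I_mul_I
  refine ⟨c1 a, c4 a, ?_⟩
  simp only [c1, c2, c3, c4] at *
  ext <;> simp [e1, e4] <;> grind

def g1 : HC →ₗ[ℂ] ℂ where
  toFun := c1
  map_add' a b := by simp [c1]; ring
  map_smul' a b := by simp [c1]; ring

def g2 : HC →ₗ[ℂ] ℂ where
  toFun := c2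
  map_add' a b := by simp [c2]; ring
  map_smul' a b := by simp [c2]; ring

def g3 : HC →ₗ[ℂ] ℂ where
  toFun := c3
  map_add' a b := by simp [c3]; ring
  map_smul' a b := by simp [c3]; ring

def g4 : HC →ₗ[ℂ] ℂ where
  toFun := c4
  map_add' a b := by simp [c4]; ring
  map_smul' a b := by simp [c4]; ring

lemma cont_coord : Continuous (fun q : HC => (q.re, q.imI, q.imJ, q.imK)) :=
  continuous_induced_dom

lemma cont_re : Continuous (fun q : HC => q.re) := continuous_fst.comp cont_coord
lemma cont_imI : Continuous (fun q : HC => q.imI) :=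
  (continuous_fst.comp continuous_snd).comp cont_coord
lemma cont_imJ : Continuous (fun q : HC => q.imJ) :=
  (continuous_fst.comp (continuous_snd.comp continuous_snd)).comp cont_coord
lemma cont_imK : Continuous (fun q : HC => q.imK) :=
  (continuous_snd.comp (continuous_snd.comp continuous_snd)).comp cont_coord

lemma cont_g1 : Continuous g1 := cont_re.sub (continuous_const.mul cont_imI)
lemma cont_g2 : Continuous g2 := cont_re.add (continuous_const.mul cont_imI)
lemma cont_g3 : Continuous g3 := (continuous_const.mul cont_imJ).neg.sub cont_imK
lemma cont_g4 : Continuous g4 := (continuous_const.mul cont_imJ).neg.add cont_imK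

lemma zeta_add (i2 i3 : HC) (p q : ℝ × ℝ × ℝ) (t : ℝ) :
    zeta i2 i3 (p + t • q) = zeta i2 i3 p + (t : ℂ) • zeta i2 i3 q := by
  simp only [zeta, Prod.fst_add, Prod.snd_add, Prod.smul_fst, Prod.smul_snd, smul_eq_mul]
  push_cast
  module

lemma zeta_eq (a₁ a₂ b₁ b₂ : ℂ) (p : ℝ × ℝ × ℝ) :
    zeta (a₁ • e1 + a₂ • e2) (b₁ • e1 + b₂ • e2) p = xi a₁ b₁ p • e1 + xi a₂ b₂ p • e2 := by
  have : (1 : HC) = e1 + e2 := by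
    ext <;> simp [e1, e2]
    norm_num
  rw [zeta, this, xi, xi]
  module

lemma xi_zero (a b : ℂ) (p : ℝ × ℝ × ℝ) (hp : p ∈ lineL a b) : xi a b p = 0 := by
  apply Complex.ext
  · simpa [xi] using hp.1
  · simpa [xi] using hp.2

lemma zeta_inj (i2 i3 : HC) (hLI : LinIndep i2 i3) (p q d : ℝ × ℝ × ℝ)
    (h : zeta i2 i3 p - zeta i2 i3 q = zeta i2 i3 d) : p = q + d := by
  have := hLI (p.1 - q.1 - d.1) (p.2.1 - q.2.1 - d.2.1) (p.2.2 - q.2.2 - d.2.2) (by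
    rw [← sub_eq_zero] at h
    rw [← h]
    simp only [zeta]
    push_cast
    module)
  ext <;> simp <;> linarith [this.1, this.2.1, this.2.2]

lemma main_aux (i2 i3 : HC) (hLI : LinIndep i2 i3) (Ω L : Set (ℝ × ℝ × ℝ))
    (hconv : ConvexInDirection Ω L)
    (Φ : HC → HC) (hΦ : LeftGMonogenic i2 i3 Φ (zeta i2 i3 '' Ω))
    (ζ₁ ζ₂ : HC) (hζ₁ : ζ₁ ∈ zeta i2 i3 '' Ω) (hζ₂ : ζ₂ ∈ zeta i2 i3 '' Ω)
    (hd : ζ₁ - ζ₂ ∈ zeta i2 i3 '' L)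
    (g : HC →ₗ[ℂ] ℂ) (hg : Continuous g) (h0 : ∀ d ∈ L, ∀ q : HC, g (q * zeta i2 i3 d) = 0) :
    g (Φ ζ₁ - Φ ζ₂) = 0 := by
  obtain ⟨p, hp, rfl⟩ := hζ₁
  obtain ⟨q, hq, rfl⟩ := hζ₂
  obtain ⟨d, hd, hd'⟩ := hd
  have hpq := zeta_inj i2 i3 hLI p q d hd'.symm
  have hs := hconv q hq p hp (by rw [hpq]; simpa using hd)
  have := aux_const i2 i3 Φ _ hΦ (zeta i2 i3 q) (zeta i2 i3 d) ⟨d, rfl⟩ (by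
    intro t ht
    rw [← zeta_add]
    refine ⟨_, hs ?_, rfl⟩
    rw [segment_eq_image']
    refine ⟨t, ht, ?_⟩
    rw [hpq]; simp) g hg (h0 d hd)
  rw [map_sub, sub_eq_zero, ← this]
  congr 2
  rw [hd']; simp

/-- Lemma 4: for a left-G-monogenic `Φ̂` on a domain convex in the directions of
`L₁`, `L₂`, differences along `L₁` (resp. `L₂`) land in the left ideal `𝓘̂₁` (resp. `𝓘̂₂`). -/
theorem statement8 (a₁ a₂ b₁ b₂ : ℂ) (i2 i3 : HC)
    (hi2 : i2 = a₁ • e1 + a₂ • e2) (hi3 : i3 = b₁ • e1 + b₂ • e2)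
    (hLI : LinIndep i2 i3)
    (Ω : Set (ℝ × ℝ × ℝ)) (hΩo : IsOpen Ω) (hΩc : IsConnected Ω)
    (hconv1 : ConvexInDirection Ω (lineL a₁ b₁)) (hconv2 : ConvexInDirection Ω (lineL a₂ b₂))
    (hab1 : a₁ ∉ Set.range ((↑) : ℝ → ℂ) ∨ b₁ ∉ Set.range ((↑) : ℝ → ℂ))
    (hab2 : a₂ ∉ Set.range ((↑) : ℝ → ℂ) ∨ b₂ ∉ Set.range ((↑) : ℝ → ℂ))
    (Φ : HC → HC) (hΦ : LeftGMonogenic i2 i3 Φ (zeta i2 i3 '' Ω))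
    (ζ₁ ζ₂ : HC) (hζ₁ : ζ₁ ∈ zeta i2 i3 '' Ω) (hζ₂ : ζ₂ ∈ zeta i2 i3 '' Ω) :
    (ζ₁ - ζ₂ ∈ zeta i2 i3 '' lineL a₁ b₁ → Φ ζ₁ - Φ ζ₂ ∈ Ih1) ∧
    (ζ₁ - ζ₂ ∈ zeta i2 i3 '' lineL a₂ b₂ → Φ ζ₁ - Φ ζ₂ ∈ Ih2) := by
  subst hi2 hi3
  have hI := Complex.I_mul_I
  constructor
  · intro hd
    apply mem_Ih1
    · refine main_aux _ _ hLI Ω _ hconv1 Φ hΦ ζ₁ ζ₂ hζ₁ hζ₂ hd g1 cont_g1 ?_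
      intro d hd q
      rw [zeta_eq, xi_zero _ _ _ hd]
      simp [g1, c1, e2]
      grind
    · refine main_aux _ _ hLI Ω _ hconv1 Φ hΦ ζ₁ ζ₂ hζ₁ hζ₂ hd g4 cont_g4 ?_
      intro d hd q
      rw [zeta_eq, xi_zero _ _ _ hd]
      simp [g4, c4, e2]
      grind
  · intro hd
    apply mem_Ih2
    · refine main_aux _ _ hLI Ω _ hconv2 Φ hΦ ζ₁ ζ₂ hζ₁ hζ₂ hd g2 cont_g2 ?_
      intro d hd q
      rw [zeta_eq, xi_zero _ _ _ hd]
      simp [g2, c2, e1]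
      grind
    · refine main_aux _ _ hLI Ω _ hconv2 Φ hΦ ζ₁ ζ₂ hζ₁ hζ₂ hd g3 cont_g3 ?_
      intro d hd q
      rw [zeta_eq, xi_zero _ _ _ hd]
      simp [g3, c3, e1]
      grind

end
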